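/- Let n ≥ 3 and let nK be the inverse limit continuum determined by the bonding map φ = nφ described in the context. Since f(v_0) = v_0, the point p = (v_0, v_0, v_0, …) lies in nK. Then every proper nondegenerate subcontinuum of nK containing p is an arc having p as an endpoint. -/

import Mathlib

/-! ## Simple-n-ods in the plane, likeness, arcs, triods, indecomposability -/

/-- The simple-`n`-od `T_n ⊆ ℂ`: the union of `n` unit segments emanating from `0`. -/
def simpleOdSet (n : ℕ) : Set ℂ :=
  {z | ∃ t : ℝ, ∃ k : ℕ, t ∈ Set.Icc (0:ℝ) 1 ∧ k < n ∧
    z = (t : ℂ) * Complex.exp (2 * Real.pi * Complex.I * (k : ℂ) / (n : ℂ))}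

/-- `X` is `Y`-like: for every `ε > 0` there is a continuous surjection `X → Y`
all of whose point-inverses have diameter `< ε`. -/
def IsLike (X Y : Type*) [MetricSpace X] [MetricSpace Y] : Prop :=
  ∀ ε : ℝ, 0 < ε → ∃ g : X → Y, Continuous g ∧ Function.Surjective g ∧
    ∀ y : Y, Metric.diam (g ⁻¹' {y}) < ε

/-- `A` is an arc: it is homeomorphic to `[0,1]`. -/
def IsArcSet {K : Type*} [TopologicalSpace K] (A : Set K) : Prop :=
  Nonempty (↥A ≃ₜ ↥(Set.Icc (0:ℝ) 1))

/-- Two sets are mutually separated: neither meets the closure of the other. -/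
def MutuallySeparated {K : Type*} [TopologicalSpace K] (A B : Set K) : Prop :=
  A ∩ closure B = ∅ ∧ closure A ∩ B = ∅

/-- The (sub)continuum `C` is a triod: it contains a subcontinuum `M` such that
`C \ M` is the union of three nonempty pairwise mutually separated sets. -/
def IsTriodSet {K : Type*} [TopologicalSpace K] (C : Set K) : Prop :=
  ∃ M A B D : Set K, IsCompact M ∧ IsConnected M ∧ M ⊆ C ∧
    A.Nonempty ∧ B.Nonempty ∧ D.Nonempty ∧ C \ M = A ∪ B ∪ D ∧
    MutuallySeparated A B ∧ MutuallySeparated A D ∧ MutuallySeparated B D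

/-- A space is atriodic if it contains no subcontinuum which is a triod. -/
def AtriodicSpace (K : Type*) [TopologicalSpace K] : Prop :=
  ∀ C : Set K, IsCompact C → IsConnected C → ¬ IsTriodSet C

/-- A space is indecomposable if it is not the union of two proper subcontinua. -/
def IndecomposableSpace (K : Type*) [TopologicalSpace K] : Prop :=
  ¬ ∃ A B : Set K, IsCompact A ∧ IsConnected A ∧ IsCompact B ∧ IsConnected B ∧
    A ≠ Set.univ ∧ B ≠ Set.univ ∧ A ∪ B = Set.univ
/-! ## The simple-`n`-od `S`, the bonding map `φ = nφ`, and the continuum `nK` -/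

noncomputable section

/-- Arm-coordinate parametrization of the simple-`n`-od in `ℂ`: the pair `(k, t)`
is sent to the point at (clamped) parameter `t ∈ [0,1]` on the ray in the
direction `e^{2πik/n}`. -/
def embC (n : ℕ) (p : ℕ × ℝ) : ℂ :=
  ((min 1 (max 0 p.2) : ℝ) : ℂ) * Complex.exp (2 * Real.pi * Complex.I * (p.1 : ℂ) / (n : ℂ))

/-- The underlying simple-`n`-od `S ⊆ ℂ`. -/
def Sset (n : ℕ) : Set ℂ := Set.range (embC n)

/-- The simple-`n`-od `S` as a (compact metric) space. -/
abbrev Sspace (n : ℕ) := ↥(Sset n)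

/-- Arm coordinates `(ray index, parameter)` of the vertices `v_0, …, v_{n+2}`
of the graph `X_0`:  `v_0` is the branch point; for `1 ≤ i ≤ n-2`, `v_i` is the tip
of ray `i - 1`; `v_{n-1}` and `v_{n+1}` are the midpoint and tip of ray `n - 2`;
`v_n` and `v_{n+2}` are the midpoint and tip of ray `n - 1`. -/
def vcoord (n i : ℕ) : ℕ × ℝ :=
  if i = 0 then (0, 0)
  else if i ≤ n - 2 then (i - 1, 1)
  else if i = n - 1 then (n - 2, 1 / 2)
  else if i = n then (n - 1, 1 / 2)
  else if i = n + 1 then (n - 2, 1)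
  else (n - 1, 1)

/-- The vertex `v_i` of `X_0` as a point of `S`. -/
def vpt (n i : ℕ) : Sspace n := ⟨embC n (vcoord n i), Set.mem_range_self _⟩

/-- The branch point `v_0` of `S`. -/
def centerPt (n : ℕ) : Sspace n := vpt n 0

/-- Affine interpolation, in arm coordinates, between two adjacent vertices of
`X_0` (they lie on a common ray; if one of them is the branch point, the ray of
the other one is used). -/
def interpC (w w' : ℕ × ℝ) (s : ℝ) : ℕ × ℝ :=
  (if w.2 = 0 then w'.1 else w.1, (1 - s) * w.2 + s * w'.2)

/-- Arm coordinates of the `φ`-image of the `j`-th vertex of `X_1` (counted from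
`v_0` outwards) on the `a`-th arm of `X_1` (`1 ≤ a ≤ n`), following the defining
table of `φ = nφ`:

* arm `a ≤ n - 3` has vertices `v_0, u_a, u_{(n-3)+a}, …, u_{2(n-1)(n-3)+a}, v_a`;
* arm `n - 2` has vertices `v_0, u_{(2n-1)(n-3)+2(n-1)+1}, v_{n-2}`;
* arm `n - 1` has vertices `v_0, u_{(2n-1)(n-3)+2(n-1)+2}, u_{(2n-1)(n-3)+2(n-1)+3},
  v_{n-1}, v_{n+1}`;
* arm `n` has vertices `v_0, u_{(2n-1)(n-3)+1}, …, u_{(2n-1)(n-3)+2(n-1)}, v_n, v_{n+2}`. -/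
def imgCoord (n a j : ℕ) : ℕ × ℝ :=
  if a = n then
    (if j = 0 then vcoord n 0
     else if j ≤ 2 * n - 2 then
       (if j = 1 then vcoord n (n - 1)
        else if j % 2 = 0 then vcoord n 0
        else if j = 3 then vcoord n (n - 2)
        else vcoord n ((j - 3) / 2))
     else if j = 2 * n - 1 then vcoord n n
     else vcoord n (n + 2))
  else if a = n - 1 then
    (if j = 0 then vcoord n 0
     else if j = 1 then vcoord n (n - 1)
     else if j = 2 then vcoord n 0
     else if j = 3 then vcoord n n
     else vcoord n (n + 2))
  else if a = n - 2 then
    (if j = 0 then vcoord n 0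
     else if j = 1 then vcoord n (n - 1)
     else vcoord n (n + 1))
  else
    (if j = 0 then vcoord n 0
     else if j ≤ 2 * n - 1 then
       (if j = 1 then vcoord n (n - 1)
        else if j = 2 * n - 1 then vcoord n n
        else if (j - 1) % 2 = 1 then vcoord n 0
        else vcoord n ((a + (j - 1) / 2 - 2) % (n - 2) + 1))
     else vcoord n (n + 2))

/-- Locating a parameter `t ∈ [0,1]` on arm `a` of the subdivision `X_1`:
returns the index `j` of the edge of `X_1` containing the point together with the
affine coordinate `s ∈ [0,1]` inside this edge.  The vertices of `X_1` are placed
at: `j/(2n)` (`0 ≤ j ≤ 2n`) on arms `a ≤ n-3`; at `0, 1/2, 1` on arm `n-2`;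
at `0, 1/6, 2/6, 3/6, 1` on arm `n-1` (the vertices `v_{n-1}`, `v_{n+1}` sit at
`1/2` and `1`); and at `j/(4n-2)` (`0 ≤ j ≤ 2n-1`) followed by `1` on arm `n`
(the vertices `v_n`, `v_{n+2}` sit at `1/2` and `1`). -/
def segOf (n a : ℕ) (t : ℝ) : ℕ × ℝ :=
  if a = n then
    (if t ≤ 1 / 2 then
      (min (2 * n - 2) ⌊(4 * (n : ℝ) - 2) * t⌋₊,
        (4 * (n : ℝ) - 2) * t - (min (2 * n - 2) ⌊(4 * (n : ℝ) - 2) * t⌋₊ : ℕ))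
     else (2 * n - 1, 2 * t - 1))
  else if a = n - 1 then
    (if t ≤ 1 / 2 then
      (min 2 ⌊6 * t⌋₊, 6 * t - (min 2 ⌊6 * t⌋₊ : ℕ))
     else (3, 2 * t - 1))
  else if a = n - 2 then
    (min 1 ⌊2 * t⌋₊, 2 * t - (min 1 ⌊2 * t⌋₊ : ℕ))
  else
    (min (2 * n - 1) ⌊2 * (n : ℝ) * t⌋₊,
      2 * (n : ℝ) * t - (min (2 * n - 1) ⌊2 * (n : ℝ) * t⌋₊ : ℕ))

/-- The bonding map `φ` in arm coordinates: a point with arm coordinates `p` lies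
on arm `a = p.1 % n + 1` at parameter `t`; it lies in the `j`-th edge of `X_1`
on this arm with affine coordinate `s`, and is mapped to the corresponding affine
combination of the `φ`-images of the endpoints of this edge. -/
def Gmap (n : ℕ) (p : ℕ × ℝ) : ℕ × ℝ :=
  interpC (imgCoord n (p.1 % n + 1) (segOf n (p.1 % n + 1) (min 1 (max 0 p.2))).1)
    (imgCoord n (p.1 % n + 1) ((segOf n (p.1 % n + 1) (min 1 (max 0 p.2))).1 + 1))
    (segOf n (p.1 % n + 1) (min 1 (max 0 p.2))).2

/-- The piecewise-linear bonding map `f : S → S` induced by `φ`. -/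
def fS (n : ℕ) : Sspace n → Sspace n := fun z =>
  ⟨embC n (Gmap n (Function.invFun (embC n) (z : ℂ))), Set.mem_range_self _⟩

/-- The continuum `nK`: the inverse limit of the sequence `S ←f S ←f S ⋯`,
realized inside the countable product `S^ℕ`. -/
abbrev nK (n : ℕ) := {x : ℕ → Sspace n // ∀ k, fS n (x (k + 1)) = x k}

end

lemma embC_param_zero (n k : ℕ) : embC n (k, 0) = 0 := by
  norm_num [embC]

lemma embC_center (n : ℕ) : embC n (0, 0) = 0 :=
  embC_param_zero n 0

lemma embC_zero (n : ℕ) : embC n 0 = 0 :=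
  embC_param_zero n 0

lemma segOf_zero (n a : ℕ) : segOf n a 0 = (0, 0) := by
  unfold segOf
  split_ifs <;> norm_num <;> linarith

lemma imgCoord_zero (n a : ℕ) : imgCoord n a 0 = (0, 0) := by
  have h : imgCoord n a 0 = vcoord n 0 := by
    unfold imgCoord
    split_ifs <;> simp_all
  rw [h]
  simp [vcoord]

/-- The branch point `v_0` is a fixed point of the bonding map: `f v_0 = v_0`. -/
lemma fS_center (n : ℕ) : fS n (centerPt n) = centerPt n := by
  apply Subtype.ext
  have hc : ((centerPt n : Sspace n) : ℂ) = 0 := by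
    simp [centerPt, vpt, vcoord, embC_center, embC_zero]
  have hex : ∃ p : ℕ × ℝ, embC n p = ((centerPt n : Sspace n) : ℂ) := ⟨(0,0), by
    rw [embC_center, hc]⟩
  have hq : embC n (Function.invFun (embC n) ((centerPt n : Sspace n) : ℂ))
      = ((centerPt n : Sspace n) : ℂ) := Function.invFun_eq hex
  set q := Function.invFun (embC n) ((centerPt n : Sspace n) : ℂ) with hqdef
  have h0 : min 1 (max 0 q.2) = (0 : ℝ) := by
    rw [hc] at hq
    unfold embC at hq
    rcases mul_eq_zero.mp hq with h | h
    · exact_mod_cast h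
    · exact absurd h (Complex.exp_ne_zero _)
  show embC n (Gmap n q) = _
  unfold Gmap
  rw [h0, segOf_zero, imgCoord_zero]
  rw [hc]
  simp only [interpC]
  norm_num
  all_goals exact embC_param_zero n _

/-- Since `f v_0 = v_0`, the point `p = (v_0, v_0, v_0, …)` lies in `nK`. -/
noncomputable def pCenter (n : ℕ) : nK n :=
  ⟨fun _ => centerPt n, fun _ => fS_center n⟩

/-- The point of `S` at parameter `t` on the ray of index `r`. -/
noncomputable def rayPt (n r : ℕ) (t : ℝ) : Sspace n := ⟨embC n (r, t), Set.mem_range_self _⟩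

/-- The parameter of the first vertex of `X_1` after `v_0` on the ray of index `r`. -/
noncomputable def firstParam (n r : ℕ) : ℝ :=
  if r = n - 1 then 1 / (4 * n - 2)
  else if r = n - 2 then 1 / 6
  else if r = n - 3 then 1 / 2
  else 1 / (2 * n)

lemma firstParam_pos {n : ℕ} (hn : 3 ≤ n) (r : ℕ) : 0 < firstParam n r := by
  have h : (3 : ℝ) ≤ n := by exact_mod_cast hn
  unfold firstParam
  split_ifs <;> [apply one_div_pos.2; skip; skip; apply one_div_pos.2] <;> linarith

lemma firstParam_le {n : ℕ} (hn : 3 ≤ n) (r : ℕ) : firstParam n r ≤ 1 / 2 := by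
  have h : (3 : ℝ) ≤ n := by exact_mod_cast hn
  unfold firstParam
  split_ifs
  · exact one_div_le_one_div_of_le (by norm_num) (by linarith)
  · norm_num
  · exact le_rfl
  · exact one_div_le_one_div_of_le (by norm_num) (by linarith)

lemma firstParam_penultimate {n : ℕ} (hn : 3 ≤ n) : firstParam n (n - 2) = 1 / 6 := by
  rw [firstParam, if_neg (by omega), if_pos rfl]

lemma embC_eq (n r : ℕ) {t : ℝ} (h0 : 0 ≤ t) (h1 : t ≤ 1) :
    embC n (r, t) = t * Complex.exp (2 * Real.pi * Complex.I / n) ^ r := by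
  unfold embC
  rw [← Complex.exp_nat_mul]
  simp only [max_eq_right h0, min_eq_right h1]
  congr 2
  ring

lemma norm_embC (n : ℕ) (q : ℕ × ℝ) : ‖embC n q‖ = min 1 (max 0 q.2) := by
  have h : (2 * Real.pi * Complex.I * (q.1 : ℂ) / (n : ℂ)) =
      ((2 * Real.pi * q.1 / n : ℝ) : ℂ) * Complex.I := by
    push_cast
    ring
  rw [embC, h, norm_mul, Complex.norm_exp_ofReal_mul_I, mul_one, Complex.norm_real,
    Real.norm_of_nonneg (le_min zero_le_one (le_max_left _ _))]

lemma norm_rayPt (n r : ℕ) {t : ℝ} (h0 : 0 ≤ t) (h1 : t ≤ 1) : ‖(rayPt n r t : ℂ)‖ = t := by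
  rw [rayPt, norm_embC]
  simp [h0, h1]

lemma rayPt_zero (n r : ℕ) : rayPt n r 0 = centerPt n := by
  apply Subtype.ext
  simp [rayPt, centerPt, vpt, vcoord, embC_param_zero]

lemma embC_mod (n : ℕ) (hn : 0 < n) (q : ℕ × ℝ) :
    embC n q = embC n (q.1 % n, min 1 (max 0 q.2)) := by
  have h0 : (0 : ℝ) ≤ min 1 (max 0 q.2) := le_min zero_le_one (le_max_left _ _)
  have h1 : min 1 (max 0 q.2) ≤ (1 : ℝ) := min_le_left _ _
  have hp := (Complex.isPrimitiveRoot_exp n hn.ne').pow_eq_one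
  rw [embC_eq n _ h0 h1, ← pow_eq_pow_mod q.1 hp, ← embC_eq n _ h0 h1]
  simp [embC, h0, h1]

lemma exists_eq_rayPt {n : ℕ} (hn : 0 < n) (z : Sspace n) :
    ∃ r < n, ∃ t, 0 ≤ t ∧ t ≤ 1 ∧ z = rayPt n r t := by
  obtain ⟨z, q, rfl⟩ := z
  refine ⟨q.1 % n, Nat.mod_lt _ hn, min 1 (max 0 q.2), le_min zero_le_one (le_max_left _ _),
    min_le_left _ _, Subtype.ext (embC_mod n hn q)⟩

lemma pow_exp_inj {n r r' : ℕ} (hr : r < n) (hr' : r' < n)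
    (h : Complex.exp (2 * Real.pi * Complex.I / n) ^ r =
      Complex.exp (2 * Real.pi * Complex.I / n) ^ r') : r = r' :=
  (Complex.isPrimitiveRoot_exp n (by omega)).pow_inj hr hr' h

lemma fS_rayPt {n r : ℕ} (hr : r < n) {t : ℝ} (h0 : 0 ≤ t) (h1 : t ≤ 1) :
    (fS n (rayPt n r t) : ℂ) = embC n (Gmap n (r, t)) := by
  have hn : 0 < n := by omega
  set q := Function.invFun (embC n) (rayPt n r t : ℂ) with hq
  have hqe : embC n q = embC n (r, t) := Function.invFun_eq ⟨(r, t), rfl⟩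
  have ht : min 1 (max 0 q.2) = t := by
    rw [← norm_embC n q, hqe, norm_embC]
    simp [h0, h1]
  rcases eq_or_lt_of_le h0 with rfl | hpos
  · rw [rayPt_zero, fS_center]
    simp [centerPt, vpt, vcoord, Gmap, segOf_zero, imgCoord_zero, interpC,
      embC_param_zero]
  · have hr' : q.1 % n = r := by
      rw [embC_mod n hn, ht, embC_eq n _ h0 h1, embC_eq n _ h0 h1] at hqe
      exact pow_exp_inj (Nat.mod_lt _ hn) hr
        (mul_left_cancel₀ (Complex.ofReal_ne_zero.2 hpos.ne') hqe)
    change embC n (Gmap n q) = _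
    unfold Gmap
    simp [ht, hr', Nat.mod_eq_of_lt hr, h0, h1]

lemma fS_rayPt_of_segOf {n r : ℕ} (hr : r < n) {t : ℝ} (h0 : 0 ≤ t) (h1 : t ≤ 1) {j : ℕ} {s : ℝ}
    (hs : segOf n (r + 1) t = (j, s)) {w w' : ℕ × ℝ} (hw : imgCoord n (r + 1) j = w)
    (hw' : imgCoord n (r + 1) (j + 1) = w') :
    fS n (rayPt n r t) = rayPt n (interpC w w' s).1 (interpC w w' s).2 := by
  apply Subtype.ext
  rw [fS_rayPt hr h0 h1]
  simp [Gmap, Nat.mod_eq_of_lt hr, h0, h1, hs, hw, hw', rayPt]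

lemma vcoord_mid {n : ℕ} (hn : 3 ≤ n) : vcoord n (n - 1) = (n - 2, 1 / 2) := by
  unfold vcoord
  rw [if_neg (by omega), if_neg (by omega), if_pos rfl]

lemma vcoord_mid_last {n : ℕ} (hn : 3 ≤ n) : vcoord n n = (n - 1, 1 / 2) := by
  unfold vcoord
  rw [if_neg (by omega), if_neg (by omega), if_neg (by omega), if_pos rfl]

lemma vcoord_tip_last {n : ℕ} (hn : 3 ≤ n) : vcoord n (n + 2) = (n - 1, 1) := by
  unfold vcoord
  rw [if_neg (by omega), if_neg (by omega), if_neg (by omega), if_neg (by omega),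
    if_neg (by omega)]

lemma imgCoord_one {n : ℕ} (hn : 3 ≤ n) (a : ℕ) : imgCoord n a 1 = (n - 2, 1 / 2) := by
  rw [← vcoord_mid hn]
  unfold imgCoord
  split_ifs <;> first | rfl | (exfalso; omega)

lemma segOf_of_lt_firstParam {n : ℕ} (hn : 3 ≤ n) (r : ℕ) {t : ℝ}
    (h1 : t < firstParam n r) : segOf n (r + 1) t = (0, t / firstParam n r) := by
  have hN : (3 : ℝ) ≤ n := by exact_mod_cast hn
  have h2 := h1.trans_le (firstParam_le hn r)
  unfold firstParam at *
  unfold segOf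
  by_cases c1 : r = n - 1
  · rw [if_pos c1] at h1 ⊢
    rw [if_pos (by omega), if_pos h2.le, Nat.floor_eq_zero.2]
    · simp [mul_comm]
    · rw [lt_div_iff₀ (by linarith)] at h1
      linarith
  rw [if_neg c1] at h1 ⊢
  rw [if_neg (by omega)]
  by_cases c2 : r = n - 2
  · rw [if_pos c2] at h1 ⊢
    rw [if_pos (by omega), if_pos h2.le, Nat.floor_eq_zero.2 (by linarith)]
    simp [mul_comm]
  rw [if_neg c2] at h1 ⊢
  rw [if_neg (by omega)]
  by_cases c3 : r = n - 3
  · rw [if_pos c3] at h1 ⊢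
    rw [if_pos (by omega), Nat.floor_eq_zero.2 (by linarith)]
    simp [mul_comm]
  rw [if_neg c3] at h1 ⊢
  rw [if_neg (by omega), Nat.floor_eq_zero.2]
  · rw [div_div_eq_mul_div, div_one]
    simp [mul_comm]
  · rw [lt_div_iff₀ (by linarith)] at h1
    linarith

lemma segOf_firstParam {n : ℕ} (hn : 3 ≤ n) (r : ℕ) :
    segOf n (r + 1) (firstParam n r) = (1, 0) := by
  have hN : (3 : ℝ) ≤ n := by exact_mod_cast hn
  have h2 := firstParam_le hn r
  unfold firstParam at *
  unfold segOf
  by_cases c1 : r = n - 1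
  · rw [if_pos c1] at h2 ⊢
    rw [if_pos (by omega), if_pos h2, mul_one_div_cancel (by linarith), Nat.floor_one,
      min_eq_right (by omega)]
    simp
  rw [if_neg c1] at h2 ⊢
  rw [if_neg (by omega)]
  by_cases c2 : r = n - 2
  · rw [if_pos c2] at h2 ⊢
    rw [if_pos (by omega), if_pos h2]
    norm_num
  rw [if_neg c2] at h2 ⊢
  rw [if_neg (by omega)]
  by_cases c3 : r = n - 3
  · rw [if_pos c3, if_pos (by omega)]
    norm_num
  rw [if_neg c3, if_neg (by omega), mul_one_div_cancel (by linarith), Nat.floor_one,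
    min_eq_right (by omega)]
  simp

/-- Near the branch point, `f` maps every ray into the ray of index `n - 2`. -/
lemma fS_of_lt_firstParam {n : ℕ} (hn : 3 ≤ n) {r : ℕ} (hr : r < n) {t : ℝ} (h0 : 0 ≤ t)
    (h1 : t < firstParam n r) :
    fS n (rayPt n r t) = rayPt n (n - 2) (t / firstParam n r * (1 / 2)) := by
  rw [fS_rayPt_of_segOf hr h0 (by linarith [firstParam_le hn r])
    (segOf_of_lt_firstParam hn r h1) (imgCoord_zero _ _) (imgCoord_one hn _)]
  simp [interpC]

lemma fS_firstParam {n : ℕ} (hn : 3 ≤ n) {r : ℕ} (hr : r < n) :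
    fS n (rayPt n r (firstParam n r)) = rayPt n (n - 2) (1 / 2) := by
  rw [fS_rayPt_of_segOf hr (firstParam_pos hn r).le (by linarith [firstParam_le hn r])
    (segOf_firstParam hn r) (imgCoord_one hn _) rfl]
  simp [interpC]

lemma fS_tip_short {n : ℕ} (hn : 3 ≤ n) : fS n (rayPt n (n - 3) 1) = rayPt n (n - 2) 1 := by
  have hs : segOf n (n - 3 + 1) 1 = (1, 1) := by
    unfold segOf
    rw [if_neg (by omega), if_neg (by omega), if_pos (by omega)]
    norm_num
  have hw : imgCoord n (n - 3 + 1) 2 = (n - 2, 1) := by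
    unfold imgCoord vcoord
    rw [if_neg (by omega), if_neg (by omega), if_pos (by omega), if_neg (by omega),
      if_neg (by omega), if_neg (by omega), if_neg (by omega), if_neg (by omega),
      if_neg (by omega), if_pos rfl]
  rw [fS_rayPt_of_segOf (by omega) zero_le_one le_rfl hs (imgCoord_one hn _) hw]
  simp [interpC]

lemma imgCoord_penultimate_three {n : ℕ} (hn : 3 ≤ n) :
    imgCoord n (n - 2 + 1) 3 = (n - 1, 1 / 2) := by
  unfold imgCoord
  rw [if_neg (by omega), if_pos (by omega), ← vcoord_mid_last hn]
  norm_num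

lemma fS_tip_penultimate {n : ℕ} (hn : 3 ≤ n) :
    fS n (rayPt n (n - 2) 1) = rayPt n (n - 1) 1 := by
  have hs : segOf n (n - 2 + 1) 1 = (3, 1) := by
    unfold segOf
    rw [if_neg (by omega), if_pos (by omega)]
    norm_num
  have hw : imgCoord n (n - 2 + 1) 4 = (n - 1, 1) := by
    unfold imgCoord
    rw [if_neg (by omega), if_pos (by omega), ← vcoord_tip_last hn]
    norm_num
  rw [fS_rayPt_of_segOf (by omega) zero_le_one le_rfl hs (imgCoord_penultimate_three hn) hw]
  simp [interpC]

lemma fS_mid_penultimate {n : ℕ} (hn : 3 ≤ n) :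
    fS n (rayPt n (n - 2) (1 / 2)) = rayPt n (n - 1) (1 / 2) := by
  have hs : segOf n (n - 2 + 1) (1 / 2) = (2, 1) := by
    unfold segOf
    rw [if_neg (by omega), if_pos (by omega)]
    norm_num
  have hw : imgCoord n (n - 2 + 1) 2 = (0, 0) := by
    unfold imgCoord
    rw [if_neg (by omega), if_pos (by omega)]
    simp [vcoord]
  rw [fS_rayPt_of_segOf (by omega) (by norm_num) (by norm_num) hs hw
    (imgCoord_penultimate_three hn)]
  simp [interpC]

lemma fS_mid_last {n : ℕ} (hn : 3 ≤ n) :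
    fS n (rayPt n (n - 1) (1 / 2)) = rayPt n (n - 1) (1 / 2) := by
  have hs : segOf n (n - 1 + 1) (1 / 2) = (2 * n - 2, 1) := by
    have h : (4 * (n : ℝ) - 2) * (1 / 2) = (2 * n - 1 : ℕ) := by
      rw [Nat.cast_sub (by omega)]
      push_cast
      ring
    unfold segOf
    rw [if_pos (by omega), if_pos le_rfl, h, Nat.floor_natCast, min_eq_left (by omega),
      Nat.cast_sub (by omega), Nat.cast_sub (by omega)]
    norm_num
  have hw : imgCoord n (n - 1 + 1) (2 * n - 2) = (0, 0) := by
    unfold imgCoord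
    rw [if_pos (by omega), if_neg (by omega), if_pos le_rfl, if_neg (by omega),
      if_pos (by omega)]
    simp [vcoord]
  have hw' : imgCoord n (n - 1 + 1) (2 * n - 2 + 1) = (n - 1, 1 / 2) := by
    unfold imgCoord
    rw [if_pos (by omega), if_neg (by omega), if_neg (by omega), if_pos (by omega),
      vcoord_mid_last hn]
  rw [fS_rayPt_of_segOf (by omega) (by norm_num) (by norm_num) hs hw hw']
  simp [interpC]

/-- The first half of the last ray covers the tips of the rays of index at most `n - 3`. -/
lemma exists_fS_last_eq_tip {n : ℕ} (hn : 3 ≤ n) {r : ℕ} (hr : r ≤ n - 3) :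
    ∃ t : ℝ, 0 < t ∧ t ≤ 1 / 2 ∧ fS n (rayPt n (n - 1) t) = rayPt n r 1 := by
  have hN : (3 : ℝ) ≤ n := by exact_mod_cast hn
  obtain ⟨j, hj0, hj, hw⟩ : ∃ j : ℕ, 0 < j ∧ j ≤ 2 * n - 2 ∧
      imgCoord n (n - 1 + 1) j = (r, 1) := by
    by_cases h : r = n - 3
    · refine ⟨3, by omega, by omega, ?_⟩
      unfold imgCoord vcoord
      rw [if_pos (by omega), if_neg (by omega), if_pos (by omega), if_neg (by omega),
        if_neg (by omega), if_pos rfl, if_neg (by omega), if_pos le_rfl]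
      congr 1
      omega
    · refine ⟨2 * r + 5, by omega, by omega, ?_⟩
      unfold imgCoord vcoord
      rw [if_pos (by omega), if_neg (by omega), if_pos (by omega), if_neg (by omega),
        if_neg (by omega), if_neg (by omega), if_neg (by omega), if_pos (by omega)]
      congr 1
      omega
  have hj' : (j : ℝ) ≤ 2 * n - 2 := by
    have : j + 2 ≤ 2 * n := by omega
    have : (j : ℝ) + 2 ≤ 2 * n := by exact_mod_cast this
    linarith
  have hle : (j : ℝ) / (4 * n - 2) ≤ 1 / 2 := by
    rw [div_le_iff₀ (by linarith)]
    linarith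
  have hpos : 0 < (j : ℝ) / (4 * n - 2) := div_pos (by exact_mod_cast hj0) (by linarith)
  have hs : segOf n (n - 1 + 1) (j / (4 * n - 2)) = (j, 0) := by
    unfold segOf
    rw [if_pos (by omega), if_pos hle, mul_div_cancel₀ _ (by linarith), Nat.floor_natCast,
      min_eq_right hj, sub_self]
  refine ⟨_, hpos, hle, ?_⟩
  rw [fS_rayPt_of_segOf (by omega) hpos.le (by linarith) hs hw rfl]
  simp [interpC]

/-- A continuous function on the plane which vanishes on all rays but the one of index `a`. -/
noncomputable def rayFun (n a : ℕ) (z : ℂ) : ℝ :=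
  ∏ b ∈ (Finset.range n).erase a, ‖z - ‖z‖ * Complex.exp (2 * Real.pi * Complex.I / n) ^ b‖

lemma continuous_rayFun (n a : ℕ) : Continuous (rayFun n a) := by
  unfold rayFun
  fun_prop

lemma rayFun_rayPt (n a r : ℕ) {t : ℝ} (h0 : 0 ≤ t) (h1 : t ≤ 1) :
    rayFun n a (rayPt n r t) = t ^ ((Finset.range n).erase a).card * rayFun n a (rayPt n r 1) := by
  unfold rayFun
  rw [← Finset.prod_const, ← Finset.prod_mul_distrib]
  refine Finset.prod_congr rfl fun b _ => ?_
  rw [norm_rayPt n r h0 h1, norm_rayPt n r zero_le_one le_rfl]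
  simp only [rayPt, embC_eq n r h0 h1, embC_eq n r zero_le_one le_rfl]
  rw [← mul_sub, norm_mul, Complex.norm_real, Real.norm_of_nonneg h0]
  simp

lemma rayFun_eq_zero {n a r : ℕ} (hr : r < n) (h : r ≠ a) {t : ℝ} (h0 : 0 ≤ t) (h1 : t ≤ 1) :
    rayFun n a (rayPt n r t) = 0 := by
  refine Finset.prod_eq_zero (Finset.mem_erase.2 ⟨h, Finset.mem_range.2 hr⟩) ?_
  rw [norm_rayPt n r h0 h1]
  simp [rayPt, embC_eq n r h0 h1]

lemma rayFun_tip_pos {n a : ℕ} (ha : a < n) : 0 < rayFun n a (rayPt n a 1) := by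
  refine Finset.prod_pos fun b hb => ?_
  rw [Finset.mem_erase, Finset.mem_range] at hb
  rw [norm_rayPt n a zero_le_one le_rfl, norm_pos_iff, sub_ne_zero]
  simp only [rayPt, embC_eq n a zero_le_one le_rfl]
  simpa using fun h => hb.1 (pow_exp_inj ha hb.2 h).symm

/-- A connected subset of `S` containing the branch point and a point of a ray contains the
segment between them. -/
lemma rayPt_mem_of_le {n : ℕ} (hn : 3 ≤ n) {B : Set (Sspace n)} (hB : IsConnected B)
    (hc : centerPt n ∈ B) {a : ℕ} (ha : a < n) {s t : ℝ} (hs : 0 < s) (hst : s ≤ t) (ht : t ≤ 1)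
    (hmem : rayPt n a t ∈ B) : rayPt n a s ∈ B := by
  have hk : ((Finset.range n).erase a).card ≠ 0 := by
    rw [Finset.card_erase_of_mem (Finset.mem_range.2 ha), Finset.card_range]
    omega
  have hC := rayFun_tip_pos ha
  have hcont : Continuous fun z : Sspace n => rayFun n a z :=
    (continuous_rayFun n a).comp continuous_subtype_val
  obtain ⟨z, hz, hzs⟩ := hB.isPreconnected.intermediate_value hc hmem hcont.continuousOn
    (show rayFun n a (rayPt n a s) ∈ _ by
      rw [← rayPt_zero n a, rayFun_rayPt n a a le_rfl zero_le_one,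
        rayFun_rayPt n a a hs.le (hst.trans ht), rayFun_rayPt n a a (hs.le.trans hst) ht,
        zero_pow hk, zero_mul]
      exact ⟨by positivity, by gcongr⟩)
  obtain ⟨r, hr, u, hu0, hu1, rfl⟩ := exists_eq_rayPt (by omega) z
  rw [rayFun_rayPt n a a hs.le (hst.trans ht)] at hzs
  dsimp only at hzs
  by_cases hra : r = a
  · subst hra
    rw [rayFun_rayPt n r r hu0 hu1] at hzs
    rwa [← (pow_left_inj₀ hu0 hs.le hk).1 (mul_right_cancel₀ hC.ne' hzs)]
  · rw [rayFun_eq_zero hr hra hu0 hu1] at hzs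
    exact absurd hzs.symm (by positivity)

lemma eq_univ_of_tips_mem {n : ℕ} (hn : 3 ≤ n) {B : Set (Sspace n)} (hB : IsConnected B)
    (hc : centerPt n ∈ B) (h : ∀ r < n, rayPt n r 1 ∈ B) : B = Set.univ := by
  refine Set.eq_univ_of_forall fun z => ?_
  obtain ⟨r, hr, t, h0, h1, rfl⟩ := exists_eq_rayPt (by omega) z
  rcases eq_or_lt_of_le h0 with rfl | hpos
  · rwa [rayPt_zero]
  · exact rayPt_mem_of_le hn hB hc hr hpos h1 le_rfl (h r hr)

/-- The projection of a subset of `nK` to its `k`-th coordinate. -/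
def coordImage {n : ℕ} (A : Set (nK n)) (k : ℕ) : Set (Sspace n) := (fun x => x.1 k) '' A

lemma continuous_coord (n k : ℕ) : Continuous fun x : nK n => x.1 k :=
  (continuous_apply k).comp continuous_subtype_val

lemma fS_mem_coordImage {n : ℕ} {A : Set (nK n)} {k : ℕ} {z : Sspace n}
    (hz : z ∈ coordImage A (k + 1)) : fS n z ∈ coordImage A k := by
  obtain ⟨x, hx, rfl⟩ := hz
  exact ⟨x, hx, (x.2 k).symm⟩

lemma coord_eq_of_le {n : ℕ} {x y : nK n} {k : ℕ} (h : x.1 k = y.1 k) :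
    ∀ j ≤ k, x.1 j = y.1 j := by
  intro j hj
  induction hj using Nat.decreasingInduction with
  | self => exact h
  | of_succ j _ ih => rw [← x.2 j, ← y.2 j, ih]

lemma coordImage_eq_univ_of_le {n : ℕ} {A : Set (nK n)} {j k : ℕ} (hjk : j ≤ k)
    (hk : coordImage A k = Set.univ) (x : nK n) : ∃ y ∈ A, y.1 j = x.1 j := by
  obtain ⟨y, hy, hyx⟩ : x.1 k ∈ coordImage A k := hk ▸ Set.mem_univ _
  exact ⟨y, hy, coord_eq_of_le hyx j hjk⟩

/-- A compact subset of `nK` with arbitrarily late full projections is the whole space. -/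
lemma eq_univ_of_coordImage {n : ℕ} {A : Set (nK n)} (hA : IsCompact A)
    (h : ∀ j, ∃ k ≥ j, coordImage A k = Set.univ) : A = Set.univ := by
  refine Set.eq_univ_of_forall fun x => ?_
  have hcl : ∀ j, IsClosed {y : nK n | y.1 j = x.1 j} := fun j =>
    isClosed_eq (continuous_coord n j) continuous_const
  obtain ⟨y, hy⟩ := IsCompact.nonempty_iInter_of_sequence_nonempty_isCompact_isClosed
    (fun j => A ∩ {y : nK n | y.1 j = x.1 j})
    (fun j y hy => ⟨hy.1, coord_eq_of_le hy.2 j (Nat.le_succ j)⟩)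
    (fun j => by
      obtain ⟨k, hk, hu⟩ := h j
      exact coordImage_eq_univ_of_le hk hu x)
    (hA.inter_right (hcl 0)) (fun j => hA.isClosed.inter (hcl j))
  rw [Set.mem_iInter] at hy
  have hyx : y = x := Subtype.ext (funext fun j => (hy j).2)
  exact hyx ▸ (hy 0).1

/-- If the projection of a subcontinuum through the branch point reaches the middle of the last
ray, then three coordinates earlier it is all of `S`. -/
lemma coordImage_eq_univ_of_mid_mem {n : ℕ} (hn : 3 ≤ n) {A : Set (nK n)}
    (hconn : ∀ k, IsConnected (coordImage A k)) (hc : ∀ k, centerPt n ∈ coordImage A k) {k : ℕ}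
    (h : rayPt n (n - 1) (1 / 2) ∈ coordImage A (k + 3)) : coordImage A k = Set.univ := by
  have step : ∀ j, rayPt n (n - 1) (1 / 2) ∈ coordImage A (j + 1) →
      rayPt n (n - 1) (1 / 2) ∈ coordImage A j ∧
        ∀ r ≤ n - 3, rayPt n r 1 ∈ coordImage A j := by
    refine fun j hj => ⟨fS_mid_last hn ▸ fS_mem_coordImage hj, fun r hr => ?_⟩
    obtain ⟨t, h0, h1, ht⟩ := exists_fS_last_eq_tip hn hr
    exact ht ▸ fS_mem_coordImage
      (rayPt_mem_of_le hn (hconn _) (hc _) (by omega) h0 h1 (by norm_num) hj)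
  have h2 := step (k + 2) h
  have h1 := step (k + 1) h2.1
  have h0 := step k h1.1
  have tip1 : rayPt n (n - 2) 1 ∈ coordImage A (k + 1) :=
    fS_tip_short hn ▸ fS_mem_coordImage (h2.2 _ le_rfl)
  have tip0 : rayPt n (n - 2) 1 ∈ coordImage A k :=
    fS_tip_short hn ▸ fS_mem_coordImage (h1.2 _ le_rfl)
  have last0 : rayPt n (n - 1) 1 ∈ coordImage A k :=
    fS_tip_penultimate hn ▸ fS_mem_coordImage tip1
  refine eq_univ_of_tips_mem hn (hconn k) (hc k) fun r hr => ?_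
  rcases (by omega : r ≤ n - 3 ∨ r = n - 2 ∨ r = n - 1) with hr | rfl | rfl
  · exact h0.2 r hr
  · exact tip0
  · exact last0

/-- The late projections of a proper subcontinuum through `p` lie in the initial edge of the ray
of index `n - 2`. -/
lemma exists_coord_eq_rayPt {n : ℕ} (hn : 3 ≤ n) {A : Set (nK n)} (hcomp : IsCompact A)
    (hconn : IsConnected A) (hproper : A ≠ Set.univ) (hpA : pCenter n ∈ A) :
    ∃ K, ∀ k ≥ K, ∀ x ∈ A, ∃ t, 0 ≤ t ∧ t < 1 / 6 ∧ x.1 k = rayPt n (n - 2) t := by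
  have hcon : ∀ k, IsConnected (coordImage A k) := fun k =>
    hconn.image _ (continuous_coord n k).continuousOn
  have hc : ∀ k, centerPt n ∈ coordImage A k := fun k => ⟨_, hpA, rfl⟩
  obtain ⟨K, hK⟩ : ∃ K, ∀ k ≥ K, coordImage A k ≠ Set.univ := by
    by_contra! h
    exact hproper (eq_univ_of_coordImage hcomp h)
  have h1 : ∀ k ≥ K, rayPt n (n - 1) (1 / 2) ∉ coordImage A (k + 3) := fun k hk h =>
    hK k hk (coordImage_eq_univ_of_mid_mem hn hcon hc h)
  have h2 : ∀ k ≥ K, rayPt n (n - 2) (1 / 2) ∉ coordImage A (k + 4) := fun k hk h =>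
    h1 k hk (fS_mid_penultimate hn ▸ fS_mem_coordImage h)
  have h3 : ∀ k ≥ K, ∀ r < n, rayPt n r (firstParam n r) ∉ coordImage A (k + 5) :=
    fun k hk r hr h => h2 k hk (fS_firstParam hn hr ▸ fS_mem_coordImage h)
  have h4 : ∀ k ≥ K, ∀ r < n, ∀ t, 0 ≤ t → t ≤ 1 → rayPt n r t ∈ coordImage A (k + 5) →
      t < firstParam n r := by
    intro k hk r hr t h0 ht hmem
    by_contra! h
    exact h3 k hk r hr (rayPt_mem_of_le hn (hcon _) (hc _) hr (firstParam_pos hn r) h ht hmem)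
  refine ⟨K + 5, fun k hk x hx => ?_⟩
  obtain ⟨k, rfl⟩ := Nat.exists_eq_add_of_le' (show 5 ≤ k by omega)
  obtain ⟨r, hr, t, h0, ht, hxt⟩ := exists_eq_rayPt (by omega) (x.1 (k + 1 + 5))
  have hlt := h4 (k + 1) (by omega) r hr t h0 ht ⟨x, hx, hxt⟩
  have hpos := firstParam_pos hn r
  have hq : t / firstParam n r < 1 := (div_lt_one hpos).2 hlt
  have hq0 : 0 ≤ t / firstParam n r := div_nonneg h0 hpos.le
  have hx5 : x.1 (k + 5) = rayPt n (n - 2) (t / firstParam n r * (1 / 2)) := by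
    rw [← x.2 (k + 5), ← fS_of_lt_firstParam hn hr h0 hlt, ← hxt]
  refine ⟨_, by positivity, ?_, hx5⟩
  have := h4 k (by omega) (n - 2) (by omega) _ (by positivity) (by linarith) ⟨x, hx, hx5⟩
  rwa [firstParam_penultimate hn] at this

lemma fS_rayPt_penultimate {n : ℕ} (hn : 3 ≤ n) {t : ℝ} (h0 : 0 ≤ t) (h1 : t < 1 / 6) :
    fS n (rayPt n (n - 2) t) = rayPt n (n - 2) (3 * t) := by
  have h := firstParam_penultimate hn
  rw [fS_of_lt_firstParam hn (by omega) h0 (h ▸ h1), h]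
  congr 1
  ring

/-- If two points of `nK` lie late in the initial edge of the ray of index `n - 2`, they are
determined by the norm of a single coordinate. -/
lemma eq_of_norm_coord_eq {n : ℕ} (hn : 3 ≤ n) {x y : nK n} {K : ℕ}
    (hx : ∀ k ≥ K, ∃ t, 0 ≤ t ∧ t < 1 / 6 ∧ x.1 k = rayPt n (n - 2) t)
    (hy : ∀ k ≥ K, ∃ t, 0 ≤ t ∧ t < 1 / 6 ∧ y.1 k = rayPt n (n - 2) t)
    (h : ‖(x.1 K : ℂ)‖ = ‖(y.1 K : ℂ)‖) : x = y := by
  have key : ∀ z : nK n,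
      (∀ k ≥ K, ∃ t, 0 ≤ t ∧ t < 1 / 6 ∧ z.1 k = rayPt n (n - 2) t) → ∀ k ≥ K,
      z.1 k = rayPt n (n - 2) ‖(z.1 k : ℂ)‖ ∧ ‖(z.1 k : ℂ)‖ = 3 * ‖(z.1 (k + 1) : ℂ)‖ := by
    intro z hz k hk
    obtain ⟨t, h0, h1, ht⟩ := hz k hk
    obtain ⟨s, hs0, hs1, hs⟩ := hz (k + 1) (by omega)
    refine ⟨by rw [ht, norm_rayPt n _ h0 (by linarith)], ?_⟩
    rw [← z.2 k, hs, fS_rayPt_penultimate hn hs0 hs1, norm_rayPt n _ hs0 (by linarith),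
      norm_rayPt n _ (by linarith) (by linarith)]
  have hnorm : ∀ k ≥ K, ‖(x.1 k : ℂ)‖ = ‖(y.1 k : ℂ)‖ := by
    intro k hk
    induction k, hk using Nat.le_induction with
    | base => exact h
    | succ k hk ih =>
      rw [(key x hx k hk).2, (key y hy k hk).2] at ih
      linarith
  have hge : ∀ k ≥ K, x.1 k = y.1 k := fun k hk => by
    rw [(key x hx k hk).1, (key y hy k hk).1, hnorm k hk]
  refine Subtype.ext (funext fun k => ?_)
  rcases le_total K k with hk | hk
  · exact hge k hk
  · exact coord_eq_of_le (hge K le_rfl) k hk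

/-- A nondegenerate continuum with a nonnegative continuous injection to the reals vanishing at
`p` is an arc with endpoint `p`. -/
lemma exists_homeomorph_Icc {X : Type*} [TopologicalSpace X] {A : Set X} (hcomp : IsCompact A)
    (hconn : IsConnected A) (hnd : A.Nontrivial) {p : X} (hp : p ∈ A) {g : X → ℝ}
    (hg : ContinuousOn g A) (hinj : Set.InjOn g A) (hnn : ∀ x ∈ A, 0 ≤ g x) (hg0 : g p = 0) :
    ∃ h : ↥(Set.Icc (0:ℝ) 1) ≃ₜ ↥A,
      ((h ⟨0, Set.left_mem_Icc.mpr zero_le_one⟩ : ↥A) : X) = p := by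
  obtain ⟨m, hm, hmax⟩ := hcomp.exists_isMaxOn hconn.nonempty hg
  obtain ⟨q, hq, hqp⟩ := hnd.exists_ne p
  have hmpos : 0 < g m := by
    refine lt_of_lt_of_le (lt_of_le_of_ne (hnn q hq) fun h => hqp ?_) (hmax hq)
    exact hinj hq hp (by rw [← h, hg0])
  have hle : ∀ x ∈ A, g x ≤ g m := fun x hx => hmax hx
  let F : A → Set.Icc (0:ℝ) 1 := fun x =>
    ⟨g x / g m, div_nonneg (hnn x x.2) hmpos.le, (div_le_one hmpos).2 (hle x x.2)⟩
  have hF : Continuous F := (hg.domRestrict.div_const (g m)).subtype_mk _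
  have hbij : Function.Bijective F := by
    constructor
    · intro x y hxy
      have := congrArg Subtype.val hxy
      exact Subtype.ext (hinj x.2 y.2 ((div_left_inj' hmpos.ne').1 this))
    · rintro ⟨t, h0, h1⟩
      obtain ⟨x, hx, hxt⟩ := hconn.isPreconnected.intermediate_value hp hm hg
        (show t * g m ∈ Set.Icc (g p) (g m) from
          ⟨by rw [hg0]; positivity, mul_le_of_le_one_left hmpos.le h1⟩)
      exact ⟨⟨x, hx⟩, Subtype.ext (by simp [F, hxt, hmpos.ne'])⟩
  have : CompactSpace A := isCompact_iff_compactSpace.1 hcomp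
  let e : A ≃ₜ Set.Icc (0:ℝ) 1 :=
    Continuous.homeoOfEquivCompactToT2 (f := Equiv.ofBijective F hbij) hF
  refine ⟨e.symm, ?_⟩
  have he : e ⟨p, hp⟩ = ⟨0, Set.left_mem_Icc.mpr zero_le_one⟩ :=
    Subtype.ext (show g p / g m = 0 by rw [hg0, zero_div])
  rw [← he, e.symm_apply_apply]

/-- For `n ≥ 3`, every proper nondegenerate subcontinuum of `nK`
containing the point `p = (v_0, v_0, v_0, …)` is an arc having `p` as an
endpoint. -/
theorem statement10 (n : ℕ) (hn : 3 ≤ n)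
    (A : Set (nK n)) (hcomp : IsCompact A) (hconn : IsConnected A)
    (hproper : A ≠ Set.univ) (hnd : A.Nontrivial) (hpA : pCenter n ∈ A) :
    ∃ h : ↥(Set.Icc (0:ℝ) 1) ≃ₜ ↥A,
      ((h ⟨0, Set.left_mem_Icc.mpr zero_le_one⟩ : ↥A) : nK n) = pCenter n := by
  obtain ⟨K, hK⟩ := exists_coord_eq_rayPt hn hcomp hconn hproper hpA
  refine exists_homeomorph_Icc hcomp hconn hnd hpA (g := fun x => ‖(x.1 K : ℂ)‖)
    (continuous_subtype_val.comp (continuous_coord n K)).norm.continuousOn ?_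
    (fun x _ => norm_nonneg _) ?_
  · exact fun x hx y hy hxy =>
      eq_of_norm_coord_eq hn (fun k hk => hK k hk x hx) (fun k hk => hK k hk y hy) hxy
  · simp [pCenter, ← rayPt_zero n 0, norm_rayPt]
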